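/- arXiv:1611.08073 — 3 statements merged into one kernel-verified Lean document; each statement's English description precedes it below -/
import Mathlib

section
/- Let γ ⊆ ℂ be a compact set such that H(t) − z·1 is invertible on ℓ²(ℤ;V) for every z ∈ γ and every t ∈ 𝕋 (i.e. γ is disjoint from the spectrum σ(H(t)) for all t). Then there exists a positive integer K such that for every integer k ≥ K and every (z,t) ∈ γ × 𝕋, the map P_{≥k}(H(t) − z)P_{≥0} : ℓ²(ℤ_{≥0};V) → ℓ²(ℤ_{≥k};V) is surjective. -/
/-!
STATEMENT 6 (Lemma 2 of the paper): Let γ ⊆ ℂ be compact with H(t) − z·1 invertible on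
ℓ²(ℤ;V) for every z ∈ γ and t ∈ 𝕋.  Then there exists a positive integer K such that for
every integer k ≥ K and every (z,t) ∈ γ × 𝕋 the compression
P≥k (H(t) − z) P≥0 : ℓ²(ℤ≥0;V) → ℓ²(ℤ≥k;V) is surjective.
-/

noncomputable section

local notation "𝕋" => Metric.sphere (0 : ℂ) 1

/-- `ℓ²(ℤ; V)`, the Hilbert space of square-summable `V`-valued sequences. -/
abbrev L2 (V : Type) [NormedAddCommGroup V] : Type := lp (fun _ : ℤ => V) 2

open Filter Topology in
/-- The tail sums of a summable family over `ℤ` tend to zero. -/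
theorem tendsto_tsum_tail_zero {a : ℤ → ℝ} (ha : Summable a) :
    Tendsto (fun k : ℤ => ∑' j : ℤ, if k ≤ j then a j else 0) atTop (𝓝 0) := by
  have h := tendsto_tsum_of_dominated_convergence (𝓕 := atTop)
    (f := fun (k : ℤ) (j : ℤ) => if k ≤ j then a j else 0) (g := fun _ => (0 : ℝ)) ha.norm
    (fun j => tendsto_const_nhds.congr' <| by
      filter_upwards [eventually_gt_atTop j] with k hk
      rw [if_neg (not_le.2 hk)])
    (Eventually.of_forall fun k j => by
      split_ifs <;> simp)
  simpa using h

/-- Translation by `j` of the sequence of norms of an `ℓ²` sequence. -/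
def normShift {V : Type} [NormedAddCommGroup V] (φ : L2 V) (j : ℤ) : L2 ℝ :=
  ⟨fun n => ‖φ (n - j)‖, memℓp_gen <| by
    have h := (lp.memℓp φ).summable (by norm_num)
    simpa [Function.comp_def] using (Equiv.subRight j).summable_iff.2 h⟩

theorem normShift_apply {V : Type} [NormedAddCommGroup V] (φ : L2 V) (j n : ℤ) :
    normShift φ j n = ‖φ (n - j)‖ := rfl

theorem norm_normShift {V : Type} [NormedAddCommGroup V] (φ : L2 V) (j : ℤ) :
    ‖normShift φ j‖ = ‖φ‖ := by
  rw [lp.norm_eq_tsum_rpow (by norm_num), lp.norm_eq_tsum_rpow (by norm_num)]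
  congr 1
  simpa [normShift_apply] using
    (Equiv.subRight j).tsum_eq fun n => ‖φ n‖ ^ (2 : ENNReal).toReal

/-- Young's inequality `ℓ¹ * ℓ² ⊆ ℓ²` for operators dominated by a convolution. -/
theorem opNorm_le_tsum_of_convolution_bound {V : Type} [NormedAddCommGroup V] [NormedSpace ℂ V]
    (G : L2 V →L[ℂ] L2 V) {b : ℤ → ℝ} (hb : ∀ j, 0 ≤ b j) (hbs : Summable b)
    (hG : ∀ (φ : L2 V) (n : ℤ), ‖G φ n‖ ≤ ∑' j : ℤ, b j * ‖φ (n - j)‖) :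
    ‖G‖ ≤ ∑' j : ℤ, b j := by
  refine G.opNorm_le_bound (tsum_nonneg hb) fun φ => ?_
  have hle : ∀ j, ‖b j • normShift φ j‖ ≤ b j * ‖φ‖ := fun j => by
    rw [norm_smul, norm_normShift, Real.norm_of_nonneg (hb j)]
  have hs : Summable fun j => b j • normShift φ j :=
    Summable.of_norm_bounded (hbs.mul_right ‖φ‖) hle
  have hcoord : ∀ n, (∑' j, b j • normShift φ j) n = ∑' j, b j * ‖φ (n - j)‖ := fun n =>
    (lp.evalCLM ℝ (fun _ : ℤ => ℝ) 2 n).map_tsum hs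
  calc ‖G φ‖ ≤ ‖∑' j, b j • normShift φ j‖ :=
        lp.norm_mono (by norm_num) fun n => by
          rw [hcoord]
          exact (hG φ n).trans (le_abs_self _)
    _ ≤ ∑' j, b j * ‖φ‖ := tsum_of_norm_bounded (hbs.mul_right ‖φ‖).hasSum hle
    _ = (∑' j, b j) * ‖φ‖ := tsum_mul_right

/-- Coordinatewise convolution of an `ℓ²` sequence with a summable family is summable. -/
theorem summable_convolution {V : Type} [NormedAddCommGroup V] [NormedSpace ℂ V]
    [CompleteSpace V] {B : ℤ → V →L[ℂ] V} (hB : Summable fun j => ‖B j‖) (φ : L2 V) (n : ℤ) :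
    Summable fun j => B j (φ (n - j)) :=
  Summable.of_norm_bounded (hB.mul_right ‖φ‖) fun j =>
    (B j).le_of_opNorm_le_of_le le_rfl (lp.norm_apply_le_norm (by norm_num) φ _)

/-- A series dominated termwise by a convolution of a summable family with the norms of an `ℓ²`
sequence is dominated by that convolution. -/
theorem norm_tsum_convolution_le {V : Type} [NormedAddCommGroup V] {u : ℤ → V} {b : ℤ → ℝ}
    (hb : ∀ j, 0 ≤ b j) (hbs : Summable b) (φ : L2 V) (n : ℤ)
    (hu : ∀ j, ‖u j‖ ≤ b j * ‖φ (n - j)‖) :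
    ‖∑' j, u j‖ ≤ ∑' j, b j * ‖φ (n - j)‖ := by
  refine tsum_of_norm_bounded (Summable.hasSum ?_) hu
  refine Summable.of_nonneg_of_le (fun j => mul_nonneg (hb j) (norm_nonneg _)) (fun j => ?_)
    (hbs.mul_right ‖φ‖)
  exact mul_le_mul_of_nonneg_left (lp.norm_apply_le_norm (by norm_num) φ _) (hb j)

open Filter Topology in
/-- A family of convolution operators depends norm-continuously on its parameter if its
coefficients do, with a uniformly summable bound. -/
theorem continuous_of_convolution {V X : Type} [NormedAddCommGroup V] [NormedSpace ℂ V]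
    [CompleteSpace V] [TopologicalSpace X] {A : ℤ → X → (V →L[ℂ] V)}
    (hAcont : ∀ j, Continuous (A j)) {a : ℤ → ℝ} (ha : Summable a) (hAa : ∀ j t, ‖A j t‖ ≤ a j)
    {H : X → (L2 V →L[ℂ] L2 V)}
    (hH : ∀ (t : X) (φ : L2 V) (n : ℤ), H t φ n = ∑' j : ℤ, A j t (φ (n - j))) :
    Continuous H := by
  have hA : ∀ t, Summable fun j => ‖A j t‖ := fun t =>
    Summable.of_nonneg_of_le (fun _ => norm_nonneg _) (fun j => hAa j t) ha
  have hbound : ∀ s t j, ‖A j t - A j s‖ ≤ a j + a j := fun s t j =>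
    (norm_sub_le _ _).trans (add_le_add (hAa j t) (hAa j s))
  have hsum : ∀ s t, Summable fun j => ‖A j t - A j s‖ := fun s t =>
    Summable.of_nonneg_of_le (fun _ => norm_nonneg _) (hbound s t) (ha.add ha)
  rw [continuous_iff_continuousAt]
  intro s
  rw [ContinuousAt, tendsto_iff_norm_sub_tendsto_zero]
  have hcont : Continuous fun t => ∑' j, ‖A j t - A j s‖ :=
    continuous_tsum (fun j => ((hAcont j).sub continuous_const).norm) (ha.add ha)
      fun j t => by simpa using hbound s t j
  have hlim : Tendsto (fun t => ∑' j, ‖A j t - A j s‖) (𝓝 s) (𝓝 0) := by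
    simpa using hcont.tendsto s
  refine squeeze_zero (fun _ => norm_nonneg _) (fun t => ?_) hlim
  refine opNorm_le_tsum_of_convolution_bound _ (fun j => norm_nonneg _) (hsum s t) fun φ n => ?_
  have hcoord : (H t - H s) φ n = ∑' j, (A j t - A j s) (φ (n - j)) := by
    have h : (H t - H s) φ n = H t φ n - H s φ n := rfl
    rw [h, hH, hH, ← (summable_convolution (hA t) φ n).tsum_sub (summable_convolution (hA s) φ n)]
    rfl
  rw [hcoord]
  exact norm_tsum_convolution_le (fun j => norm_nonneg _) (hsum s t) φ n
    fun j => ContinuousLinearMap.le_opNorm _ _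

/-- The block of a convolution operator leading from negative degrees to degrees `≥ k` is
bounded by the tail of its coefficients; a scalar multiple of the identity does not contribute. -/
theorem norm_offDiagonal_block_le {V : Type} [NormedAddCommGroup V] [NormedSpace ℂ V]
    {B : ℤ → V →L[ℂ] V} {a : ℤ → ℝ} (ha : Summable a) (hBa : ∀ j, ‖B j‖ ≤ a j)
    {T : L2 V →L[ℂ] L2 V} (hT : ∀ (φ : L2 V) (n : ℤ), T φ n = ∑' j : ℤ, B j (φ (n - j)))
    {P : ℤ → (L2 V →L[ℂ] L2 V)}
    (hP : ∀ (m : ℤ) (φ : L2 V) (n : ℤ), P m φ n = if m ≤ n then φ n else 0)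
    (z : ℂ) {k : ℤ} (hk : 0 ≤ k) :
    ‖P k * ((T - z • 1) * (1 - P 0))‖ ≤ ∑' j : ℤ, if k ≤ j then a j else 0 := by
  have ha0 : ∀ j, 0 ≤ a j := fun j => (norm_nonneg _).trans (hBa j)
  have hb0 : ∀ j, 0 ≤ if k ≤ j then a j else 0 := fun j => by
    split_ifs <;> simp [ha0]
  have hbs : Summable fun j => if k ≤ j then a j else 0 := by
    refine Summable.of_nonneg_of_le hb0 (fun j => ?_) ha
    split_ifs <;> simp [ha0]
  refine opNorm_le_tsum_of_convolution_bound _ hb0 hbs fun φ n => ?_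
  set χ : L2 V := (1 - P 0) φ with hχ
  have hχn : ∀ m, χ m = if 0 ≤ m then 0 else φ m := fun m => by
    have h : χ m = φ m - P 0 φ m := rfl
    rw [h, hP]
    split_ifs <;> simp
  have hcoord : (P k * ((T - z • 1) * (1 - P 0))) φ n = P k ((T - z • 1) χ) n := rfl
  have hval : (T - z • 1) χ n = T χ n - z • χ n := rfl
  rw [hcoord, hP]
  split_ifs with hkn
  · rw [hval, hχn n, if_pos (hk.trans hkn), smul_zero, sub_zero, hT]
    refine norm_tsum_convolution_le hb0 hbs φ n fun j => ?_
    rw [hχn]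
    split_ifs with h1 h2 h2
    · simpa using mul_nonneg (ha0 j) (norm_nonneg _)
    · simp
    · exact (B j).le_of_opNorm_le (hBa j) _
    · omega
  · simpa using tsum_nonneg fun j => mul_nonneg (hb0 j) (norm_nonneg _)

/-- If `S` is a right inverse of `T` and `P T (1 - Q) S` has norm less than one, then the
compression `P T Q` maps onto the range of the idempotent `P`. -/
theorem exists_compression_eq {E : Type*} [NormedAddCommGroup E] [NormedSpace ℂ E]
    [CompleteSpace E] {P Q T S : E →L[ℂ] E} (hPP : ∀ x, P (P x) = P x) (hQQ : ∀ x, Q (Q x) = Q x)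
    (hTS : T * S = 1) (hlt : ‖P * (T * (1 - Q)) * S‖ < 1) {ψ : E} (hψ : P ψ = ψ) :
    ∃ φ, Q φ = φ ∧ P (T (Q φ)) = ψ := by
  obtain ⟨u, hu⟩ := isUnit_one_sub_of_norm_lt_one hlt
  set χ : E := (↑u⁻¹ : E →L[ℂ] E) ψ
  have hχ : χ - P (T (S χ - Q (S χ))) = ψ := by
    have h : (1 - P * (T * (1 - Q)) * S) χ = ψ := by
      rw [← hu]
      exact congrArg (fun f : E →L[ℂ] E => f ψ) u.mul_inv
    exact h
  have hTSχ : T (S χ) = χ := congrArg (fun f : E →L[ℂ] E => f χ) hTS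
  have hPχ : P χ = χ := by
    have h := congrArg P hχ
    rw [map_sub, hPP, hψ] at h
    exact sub_left_inj.1 (h.trans hχ.symm)
  refine ⟨Q (S χ), hQQ _, ?_⟩
  rw [hQQ]
  rw [map_sub, map_sub, hTSχ, hPχ, sub_sub_cancel] at hχ
  exact hχ

theorem compression_surjective_for_large_k
    {V : Type} [NormedAddCommGroup V] [InnerProductSpace ℂ V] [FiniteDimensional ℂ V]
    (A : ℤ → 𝕋 → (V →L[ℂ] V)) (hAcont : ∀ j, Continuous (A j))
    (hAsum : Summable fun j : ℤ => ⨆ t : 𝕋, ‖A j t‖)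
    (H : 𝕋 → (L2 V →L[ℂ] L2 V))
    (hH : ∀ (t : 𝕋) (φ : L2 V) (n : ℤ), H t φ n = ∑' j : ℤ, A j t (φ (n - j)))
    (hSA : ∀ t : 𝕋, IsSelfAdjoint (H t))
    (P : ℤ → (L2 V →L[ℂ] L2 V))
    (hP : ∀ (m : ℤ) (φ : L2 V) (n : ℤ), P m φ n = if m ≤ n then φ n else 0)
    (γ : Set ℂ) (hγ : IsCompact γ)
    (hinv : ∀ z ∈ γ, ∀ t : 𝕋, IsUnit (H t - z • (1 : L2 V →L[ℂ] L2 V))) :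
    ∃ K : ℕ, 0 < K ∧ ∀ k : ℤ, (K : ℤ) ≤ k → ∀ z ∈ γ, ∀ t : 𝕋,
      ∀ ψ : L2 V, (∀ n : ℤ, n < k → ψ n = 0) →
        ∃ φ : L2 V, (∀ n : ℤ, n < 0 → φ n = 0) ∧
          ((P k).comp ((H t - z • 1).comp (P 0))) φ = ψ := by
  have hV : CompleteSpace V := FiniteDimensional.complete ℂ V
  have hAa : ∀ j t, ‖A j t‖ ≤ ⨆ t : 𝕋, ‖A j t‖ := fun j t =>
    le_ciSup (isCompact_range (hAcont j).norm).bddAbove t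
  have hHcont : Continuous H := continuous_of_convolution hAcont hAsum hAa hH
  have hinvcont : ContinuousOn
      (fun p : ℂ × 𝕋 => Ring.inverse (H p.2 - p.1 • (1 : L2 V →L[ℂ] L2 V)))
      (γ ×ˢ Set.univ) := by
    rintro ⟨z, t⟩ ⟨hz, -⟩
    obtain ⟨u, hu⟩ := hinv z hz t
    have hsub : Continuous fun p : ℂ × 𝕋 => H p.2 - p.1 • (1 : L2 V →L[ℂ] L2 V) :=
      (hHcont.comp continuous_snd).sub (continuous_fst.smul continuous_const)
    have hinvAt := NormedRing.inverse_continuousAt u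
    rw [hu] at hinvAt
    exact (ContinuousAt.comp (f := fun p : ℂ × 𝕋 => H p.2 - p.1 • (1 : L2 V →L[ℂ] L2 V))
      (x := (z, t)) hinvAt hsub.continuousAt).continuousWithinAt
  obtain ⟨C, hC⟩ := (hγ.prod isCompact_univ).exists_bound_of_continuousOn hinvcont
  have htail : ∀ᶠ k : ℤ in Filter.atTop,
      (∑' j : ℤ, if k ≤ j then ⨆ t : 𝕋, ‖A j t‖ else 0) * C < 1 := by
    have h := (tendsto_tsum_tail_zero hAsum).mul_const C
    rw [zero_mul] at h
    exact h.eventually_lt_const one_pos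
  obtain ⟨k₀, hk₀⟩ := Filter.eventually_atTop.1 htail
  have hPP : ∀ m φ, P m (P m φ) = P m φ := fun m φ => lp.ext <| funext fun n => by
    simp only [hP]
    split_ifs <;> rfl
  refine ⟨(max k₀ 1).toNat, by omega, fun k hk z hz t ψ hψ => ?_⟩
  have hψP : P k ψ = ψ := lp.ext <| funext fun n => by
    rw [hP]
    split_ifs with h
    · rfl
    · exact (hψ n (not_le.1 h)).symm
  have hlt : ‖P k * ((H t - z • 1) * (1 - P 0)) * Ring.inverse (H t - z • 1)‖ < 1 := by
    refine (norm_mul_le _ _).trans_lt (lt_of_le_of_lt ?_ (hk₀ k (by omega)))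
    have hblock := norm_offDiagonal_block_le hAsum (fun j => hAa j t) (hH t) hP z
      (show 0 ≤ k by omega)
    exact mul_le_mul hblock (hC (z, t) ⟨hz, Set.mem_univ t⟩) (norm_nonneg _)
      ((norm_nonneg _).trans hblock)
  obtain ⟨φ, hφ, h⟩ := exists_compression_eq (hPP k) (hPP 0)
    (Ring.mul_inverse_cancel _ (hinv z hz t)) hlt hψP
  refine ⟨φ, fun n hn => ?_, h⟩
  rw [← hφ, hP, if_neg (not_le.2 hn)]
end
end

section
/- Let A be a complex unital Banach algebra, U ⊆ ℂ an open set, and D : U → A a holomorphic map. Let c ∈ ℂ and R > 0 be such that for every z ∈ U and every λ ∈ ℂ with |λ − c| = R, the element λ·1 − D(z) is invertible in A. Then p(z) := (1/2πi) ∮_{|λ−c|=R} (λ·1 − D(z))^{−1} dλ defines a holomorphic map p : U → A satisfying p(z)² = p(z) for every z ∈ U (the Riesz projection associated with the spectrum of D(z) inside the circle). -/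
noncomputable section

open scoped Real
open Set Metric MeasureTheory Topology Filter

theorem ContinuousLinearMap.circleIntegral_comp_comm {E F : Type*}
    [NormedAddCommGroup E] [NormedSpace ℂ E] [CompleteSpace E]
    [NormedAddCommGroup F] [NormedSpace ℂ F] [CompleteSpace F] (L : E →L[ℂ] F)
    {f : ℂ → E} {c : ℂ} {R : ℝ} (hf : CircleIntegrable f c R) :
    (∮ z in C(c, R), L (f z)) = L (∮ z in C(c, R), f z) := by
  simp only [circleIntegral, ← map_smul]
  exact L.intervalIntegral_comp_comm hf.out

theorem circleIntegral_circleIntegral_swap {E : Type*} [NormedAddCommGroup E] [NormedSpace ℂ E]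
    {c₁ c₂ : ℂ} {R₁ R₂ : ℝ} (h₁ : 0 ≤ R₁) (h₂ : 0 ≤ R₂) {f : ℂ → ℂ → E}
    (hf : ContinuousOn (Function.uncurry f) (sphere c₁ R₁ ×ˢ sphere c₂ R₂)) :
    (∮ z in C(c₁, R₁), ∮ w in C(c₂, R₂), f z w) =
      ∮ w in C(c₂, R₂), ∮ z in C(c₁, R₁), f z w := by
  have hcont : Continuous fun p : ℝ × ℝ => f (circleMap c₁ R₁ p.1) (circleMap c₂ R₂ p.2) :=
    hf.comp_continuous (f := fun p : ℝ × ℝ => (circleMap c₁ R₁ p.1, circleMap c₂ R₂ p.2))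
      (by fun_prop) fun p => ⟨circleMap_mem_sphere _ h₁ _, circleMap_mem_sphere _ h₂ _⟩
  simp only [circleIntegral, ← intervalIntegral.integral_smul]
  rw [intervalIntegral_intervalIntegral_swap]
  · simp only [smul_comm (deriv (circleMap c₁ R₁) _)]
  · refine IntegrableOn.mono_set (t := uIcc 0 (2 * π) ×ˢ uIcc 0 (2 * π)) ?_
      (prod_mono uIoc_subset_uIcc uIoc_subset_uIcc)
    refine ContinuousOn.integrableOn_compact (isCompact_uIcc.prod isCompact_uIcc) ?_
    refine Continuous.continuousOn ?_
    simp only [Function.uncurry_def, deriv_circleMap]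
    exact (((continuous_circleMap 0 R₁).comp continuous_fst).mul continuous_const).smul
      ((((continuous_circleMap 0 R₂).comp continuous_snd).mul continuous_const).smul hcont)

theorem differentiableOn_circleIntegral_param {E : Type*} [NormedAddCommGroup E] [NormedSpace ℂ E]
    {U : Set ℂ} (hU : IsOpen U) {c : ℂ} {R : ℝ} (hR : 0 ≤ R) {F F' : ℂ → ℂ → E}
    (hF : ContinuousOn (Function.uncurry F) (U ×ˢ sphere c R))
    (hF' : ContinuousOn (Function.uncurry F') (U ×ˢ sphere c R))
    (hderiv : ∀ z ∈ U, ∀ w ∈ sphere c R, HasDerivAt (fun z => F z w) (F' z w) z) :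
    DifferentiableOn ℂ (fun z => ∮ w in C(c, R), F z w) U := by
  intro z₀ hz₀
  obtain ⟨ε, hε, hball⟩ := nhds_basis_closedBall.mem_iff.1 (hU.mem_nhds hz₀)
  obtain ⟨C, hC⟩ :=
    ((isCompact_closedBall z₀ ε).prod (isCompact_sphere c R)).exists_bound_of_continuousOn
      (hF'.mono (prod_mono hball Subset.rfl))
  have hslice : ∀ {G : ℂ → ℂ → E}, ContinuousOn (Function.uncurry G) (U ×ˢ sphere c R) →
      ∀ z ∈ U, Continuous fun θ => deriv (circleMap c R) θ • G z (circleMap c R θ) := by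
    intro G hG z hz
    have : Continuous fun θ => G z (circleMap c R θ) :=
      hG.comp_continuous (f := fun θ : ℝ => (z, circleMap c R θ)) (by fun_prop)
        fun θ => ⟨hz, circleMap_mem_sphere _ hR _⟩
    simp only [deriv_circleMap]
    exact ((continuous_circleMap 0 R).mul continuous_const).smul this
  refine (intervalIntegral.hasDerivAt_integral_of_dominated_loc_of_deriv_le
    (F' := fun z θ => deriv (circleMap c R) θ • F' z (circleMap c R θ))
    (bound := fun _ => R * C)
    (closedBall_mem_nhds z₀ hε) ?_ ((hslice hF z₀ hz₀).intervalIntegrable _ _)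
    (hslice hF' z₀ hz₀).aestronglyMeasurable ?_ intervalIntegrable_const
    ?_).2.differentiableAt.differentiableWithinAt
  · filter_upwards [hU.mem_nhds hz₀] with z hz using (hslice hF z hz).aestronglyMeasurable
  · refine Eventually.of_forall fun θ _ z hz => ?_
    rw [norm_smul]
    have hd : ‖deriv (circleMap c R) θ‖ = R := by simp [deriv_circleMap, abs_of_nonneg hR]
    rw [hd]
    exact mul_le_mul_of_nonneg_left (hC (z, _) ⟨hz, circleMap_mem_sphere _ hR _⟩) hR
  · exact Eventually.of_forall fun θ _ z hz =>
      (hderiv z (hball hz) _ (circleMap_mem_sphere _ hR _)).const_smul _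

theorem exists_annulus_subset_of_sphere_subset {V : Set ℂ} (hV : IsOpen V) {c : ℂ} {R : ℝ}
    (hR : 0 < R) (h : sphere c R ⊆ V) :
    ∃ r, 0 < r ∧ r < R ∧ closedBall c R \ ball c r ⊆ V := by
  have hK : IsCompact (closedBall c R \ V) := (isCompact_closedBall c R).diff hV
  have hsub : closedBall c R \ V ⊆ ball c R := fun z hz =>
    lt_of_le_of_ne hz.1 fun heq => hz.2 (h heq)
  obtain ⟨r, hr, hrK⟩ := exists_pos_lt_subset_ball hR hK.isClosed hsub
  exact ⟨r, hr.1, hr.2, fun z hz => by_contra fun hzV => hz.2 (hrK ⟨hz.1, hzV⟩)⟩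

theorem spectrum.isIdempotentElem_circleIntegral_resolvent {A : Type*} [NormedRing A]
    [NormedAlgebra ℂ A] [CompleteSpace A] (a : A) {c : ℂ} {R : ℝ} (hR : 0 < R)
    (h : sphere c R ⊆ resolventSet ℂ a) :
    IsIdempotentElem ((2 * π * Complex.I : ℂ)⁻¹ • ∮ w in C(c, R), resolvent a w) := by
  obtain ⟨r, hr, hrR, hann⟩ :=
    exists_annulus_subset_of_sphere_subset (isOpen_resolventSet a) hR h
  have hdiff : ∀ z ∈ resolventSet ℂ a, DifferentiableAt ℂ (resolvent a) z := fun z hz =>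
    (hasDerivAt_resolvent_const_left hz).differentiableAt
  have hcont : ContinuousOn (resolvent a) (resolventSet ℂ a) := fun z hz =>
    (hdiff z hz).continuousAt.continuousWithinAt
  have hshrink : (∮ w in C(c, R), resolvent a w) = ∮ w in C(c, r), resolvent a w :=
    Complex.circleIntegral_eq_of_differentiable_on_annulus_off_countable hr hrR.le
      countable_empty (hcont.mono hann) fun z hz =>
        hdiff z (hann ⟨ball_subset_closedBall hz.1.1, fun hb => hz.1.2 (ball_subset_closedBall hb)⟩)
  have hsr : sphere c r ⊆ resolventSet ℂ a := fun z hz =>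
    hann ⟨by simpa [mem_sphere.1 hz] using hrR.le, by simp [mem_sphere.1 hz]⟩
  have hne : ∀ z ∈ sphere c R, ∀ w ∈ sphere c r, z - w ≠ 0 := by
    intro z hz w hw hzw
    rw [sub_eq_zero.1 hzw, mem_sphere] at hz
    rw [mem_sphere] at hw
    linarith
  have hresolvent : ∀ z ∈ sphere c R, ∀ w ∈ sphere c r,
      resolvent a z * resolvent a w = (z - w)⁻¹ • resolvent a w - (z - w)⁻¹ • resolvent a z := by
    intro z hz w hw
    have hz' : IsUnit (algebraMap ℂ A z - a) := h hz
    have hw' : IsUnit (algebraMap ℂ A w - a) := hsr hw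
    rw [← smul_sub, eq_inv_smul_iff₀ (hne z hz w hw), resolvent, resolvent,
      ← neg_sub (Ring.inverse _), Ring.inverse_sub_inverse (iff_of_true hz' hw')]
    simp only [Algebra.algebraMap_eq_smul_one, sub_sub_sub_cancel_right, ← sub_smul]
    simp [← neg_smul]
  have hleft : ∀ z ∈ sphere c R, resolvent a z * (∮ w in C(c, r), resolvent a w) =
      ∮ w in C(c, r), (z - w)⁻¹ • resolvent a w := by
    intro z hz
    have hinv : ContinuousOn (fun w => (z - w)⁻¹) (sphere c r) :=
      (continuousOn_const.sub continuousOn_id).inv₀ (hne z hz)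
    have hinv_ball : ∀ w ∈ closedBall c r, z - w ≠ 0 := by
      intro w hw hzw
      rw [← sub_eq_zero.1 hzw, mem_closedBall, mem_sphere.1 hz] at hw
      linarith
    have hzero : (∮ w in C(c, r), (z - w)⁻¹ • resolvent a z) = 0 := by
      rw [circleIntegral.integral_smul_const,
        Complex.circleIntegral_eq_zero_of_differentiable_on_off_countable hr.le countable_empty,
        zero_smul]
      · exact (continuousOn_const.sub continuousOn_id).inv₀ hinv_ball
      · intro w hw
        exact (differentiableAt_id.const_sub z).inv (hinv_ball w (ball_subset_closedBall hw.1))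
    calc resolvent a z * (∮ w in C(c, r), resolvent a w)
        = ∮ w in C(c, r), resolvent a z * resolvent a w :=
          ((ContinuousLinearMap.mul ℂ A (resolvent a z)).circleIntegral_comp_comm
            ((hcont.mono hsr).circleIntegrable hr.le)).symm
      _ = ∮ w in C(c, r), ((z - w)⁻¹ • resolvent a w - (z - w)⁻¹ • resolvent a z) :=
          circleIntegral.integral_congr hr.le fun w hw => hresolvent z hz w hw
      _ = _ := by
          have hsub := circleIntegral.integral_sub
            ((hinv.smul (hcont.mono hsr)).circleIntegrable hr.le)
            ((hinv.smul (continuousOn_const (c := resolvent a z))).circleIntegrable hr.le)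
          simp only [Pi.smul_apply'] at hsub
          rw [hsub, hzero, sub_zero]
  have hmul : (∮ z in C(c, R), resolvent a z) * (∮ w in C(c, r), resolvent a w) =
      (2 * π * Complex.I : ℂ) • ∮ w in C(c, r), resolvent a w := by
    calc (∮ z in C(c, R), resolvent a z) * (∮ w in C(c, r), resolvent a w)
        = ∮ z in C(c, R), resolvent a z * (∮ w in C(c, r), resolvent a w) :=
          (((ContinuousLinearMap.mul ℂ A).flip
            (∮ w in C(c, r), resolvent a w)).circleIntegral_comp_comm
              ((hcont.mono h).circleIntegrable hR.le)).symm
      _ = ∮ z in C(c, R), ∮ w in C(c, r), (z - w)⁻¹ • resolvent a w :=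
          circleIntegral.integral_congr hR.le hleft
      _ = ∮ w in C(c, r), ∮ z in C(c, R), (z - w)⁻¹ • resolvent a w := by
          refine circleIntegral_circleIntegral_swap hR.le hr.le ?_
          refine ContinuousOn.smul ?_ ((hcont.mono hsr).comp continuousOn_snd fun p hp => hp.2)
          exact (continuousOn_fst.sub continuousOn_snd).inv₀ fun p hp => hne _ hp.1 _ hp.2
      _ = ∮ w in C(c, r), (2 * π * Complex.I : ℂ) • resolvent a w := by
          refine circleIntegral.integral_congr hr.le fun w hw => ?_
          have hw' : w ∈ ball c R := by rw [mem_ball, mem_sphere.1 hw]; exact hrR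
          simp only [circleIntegral.integral_smul_const,
            circleIntegral.integral_sub_inv_of_mem_ball hw']
      _ = _ := circleIntegral.integral_smul _ _ _ _
  rw [IsIdempotentElem, smul_mul_smul_comm]
  nth_rewrite 2 [hshrink]
  rw [hmul, hshrink, smul_smul, mul_assoc, inv_mul_cancel₀ Complex.two_pi_I_ne_zero, mul_one]

theorem riesz_projection_holomorphic_idempotent
    {A : Type} [NormedRing A] [NormedAlgebra ℂ A] [CompleteSpace A]
    (U : Set ℂ) (hU : IsOpen U) (D : ℂ → A) (hD : DifferentiableOn ℂ D U)
    (c : ℂ) (R : ℝ) (hR : 0 < R)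
    (hinv : ∀ z ∈ U, ∀ lam : ℂ, ‖lam - c‖ = R → IsUnit (lam • (1 : A) - D z)) :
    DifferentiableOn ℂ
      (fun z : ℂ => (2 * Real.pi * Complex.I : ℂ)⁻¹ •
        ∮ lam in C(c, R), Ring.inverse (lam • (1 : A) - D z)) U ∧
    ∀ z ∈ U,
      ((2 * Real.pi * Complex.I : ℂ)⁻¹ •
          ∮ lam in C(c, R), Ring.inverse (lam • (1 : A) - D z)) *
        ((2 * Real.pi * Complex.I : ℂ)⁻¹ •
          ∮ lam in C(c, R), Ring.inverse (lam • (1 : A) - D z))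
      = (2 * Real.pi * Complex.I : ℂ)⁻¹ •
          ∮ lam in C(c, R), Ring.inverse (lam • (1 : A) - D z) := by
  have hunit : ∀ p ∈ U ×ˢ sphere c R, IsUnit (p.2 • (1 : A) - D p.1) := fun p hp =>
    hinv p.1 hp.1 p.2 (mem_sphere_iff_norm.1 hp.2)
  constructor
  · have hcont : ContinuousOn (fun p : ℂ × ℂ => Ring.inverse (p.2 • (1 : A) - D p.1))
        (U ×ˢ sphere c R) := by
      intro p hp
      refine ContinuousAt.comp_continuousWithinAt (g := Ring.inverse)
        (differentiableAt_inverse (𝕜 := ℂ) (hunit p hp)).continuousAt ?_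
      exact (continuousWithinAt_snd.smul continuousWithinAt_const).sub
        ((hD.continuousOn.comp continuousOn_fst fun p hp => hp.1) p hp)
    have hcont_deriv : ContinuousOn (fun p : ℂ × ℂ => deriv D p.1) (U ×ˢ sphere c R) :=
      (hD.deriv hU).continuousOn.comp continuousOn_fst fun p hp => hp.1
    refine DifferentiableOn.const_smul (differentiableOn_circleIntegral_param hU hR.le
      (F := fun z lam => Ring.inverse (lam • (1 : A) - D z))
      (F' := fun z lam => Ring.inverse (lam • (1 : A) - D z) * deriv D z *
        Ring.inverse (lam • (1 : A) - D z))
      hcont ((hcont.mul hcont_deriv).mul hcont) ?_) (2 * π * Complex.I : ℂ)⁻¹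
    intro z hz lam hlam
    obtain ⟨u, hu⟩ := hunit (z, lam) ⟨hz, hlam⟩
    have hinverse := hasFDerivAt_ringInverse (𝕜 := ℂ) u
    dsimp only at hu
    rw [hu] at hinverse
    have hDz := ((hD.differentiableAt (hU.mem_nhds hz)).hasDerivAt).const_sub (lam • (1 : A))
    simpa [← hu, Function.comp_def] using hinverse.comp_hasDerivAt z hDz
  · intro z hz
    simpa only [IsIdempotentElem, resolvent, Algebra.algebraMap_eq_smul_one] using
      spectrum.isIdempotentElem_circleIntegral_resolvent (D z) hR fun lam hlam => by
        rw [spectrum.mem_resolventSet_iff, Algebra.algebraMap_eq_smul_one]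
        exact hunit (z, lam) ⟨hz, hlam⟩
end
end

section
/- Suppose k ≥ 1, A_j = 0 for all |j| > k, and fix t ∈ 𝕋 such that A_k(t) and A_{−k}(t) are invertible in End_ℂ(V). Fix z ∈ ℂ. Let W_{z,t} be the space of all sequences ψ : ℤ → V satisfying Σ_{j=−k}^{k} A_j(t) ψ_{n−j} = z ψ_n for every n ∈ ℤ and Σ_{n≥0} ‖ψ_n‖² < ∞. Then the restriction map ψ ↦ (ψ_n)_{n≥0} is a linear bijection from W_{z,t} onto (E_GP)_{z,t} = {φ ∈ ℓ²(ℤ_{≥0};V) : ((H(t) − z)φ)_n = 0 for all n ≥ k}. -/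
/-!
STATEMENT 15 (Remark 9 of the paper): Suppose k ≥ 1, A_j = 0 for |j| > k, and A_k(t),
A_{−k}(t) are invertible.  Let W_{z,t} be the space of sequences ψ : ℤ → V with
Σ_{j=−k}^{k} A_j(t) ψ_{n−j} = z ψ_n for all n ∈ ℤ and Σ_{n≥0} ‖ψ_n‖² < ∞.  Then the
restriction ψ ↦ (ψ_n)_{n≥0} is a linear bijection from W_{z,t} onto
(E_GP)_{z,t} = {φ ∈ ℓ²(ℤ≥0;V) : ((H(t) − z)φ)ₙ = 0 for all n ≥ k}, where ℓ²(ℤ≥0;V) is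
the subspace of ℓ²(ℤ;V) of sequences vanishing in negative degrees.
The bijectivity is expressed as: the restriction map is well-defined into (E_GP)_{z,t},
injective, and surjective.
-/

noncomputable section

local notation "𝕋" => Metric.sphere (0 : ℂ) 1

/-- Extension of a sequence on the nonnegative integers to `ℤ` by the backward recursion
`ψ m = F ψ m`, where `F` is given the values of `ψ` on `(m, ∞)`. -/
def backwardExtend {V : Type} [Zero V] (F : (ℤ → V) → ℤ → V) (φ : ℤ → V) (m : ℤ) : V :=
  if 0 ≤ m then φ m
  else F (fun l => if m < l then backwardExtend F φ l else 0) m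
termination_by (-m).toNat
decreasing_by omega

theorem backwardExtend_of_nonneg {V : Type} [Zero V] (F : (ℤ → V) → ℤ → V) (φ : ℤ → V)
    {m : ℤ} (hm : 0 ≤ m) : backwardExtend F φ m = φ m := by
  rw [backwardExtend, if_pos hm]

theorem backwardExtend_of_neg {V : Type} [Zero V] (F : (ℤ → V) → ℤ → V) (φ : ℤ → V)
    (hF : ∀ m ψ ψ', (∀ l, m < l → ψ l = ψ' l) → F ψ m = F ψ' m)
    {m : ℤ} (hm : m < 0) : backwardExtend F φ m = F (backwardExtend F φ) m := by
  rw [backwardExtend, if_neg hm.not_ge]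
  exact hF _ _ _ fun l hl => if_pos hl

theorem sum_Icc_neg_eq_add_sum_Ico {M : Type*} [AddCommMonoid M] (f : ℤ → M) {k : ℤ}
    (hk : 0 ≤ k) :
    ∑ j ∈ Finset.Icc (-k) k, f j = f k + ∑ j ∈ Finset.Ico (-k) k, f j := by
  rw [← Finset.Ico_insert_right (by omega : -k ≤ k), Finset.sum_insert (by simp)]

/-- Two solutions of a finite-range difference equation with injective leading coefficient agree
as soon as they agree on the nonnegative integers. -/
theorem eq_of_recurrence_of_eq_nonneg {V : Type} [NormedAddCommGroup V] [NormedSpace ℂ V]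
    (a : ℤ → V →L[ℂ] V) {k : ℤ} (hk : 1 ≤ k) (hak : Function.Injective (a k)) (z : ℂ)
    {ψ ψ' : ℤ → V}
    (h : ∀ n : ℤ, ∑ j ∈ Finset.Icc (-k) k, a j (ψ (n - j)) = z • ψ n)
    (h' : ∀ n : ℤ, ∑ j ∈ Finset.Icc (-k) k, a j (ψ' (n - j)) = z • ψ' n)
    (heq : ∀ n : ℤ, 0 ≤ n → ψ n = ψ' n) : ψ = ψ' := by
  have key : ∀ N : ℕ, ∀ n : ℤ, -(N : ℤ) ≤ n → ψ n = ψ' n := by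
    intro N
    induction N with
    | zero => intro n hn; exact heq n (by simpa using hn)
    | succ N ih =>
      intro n hn
      by_cases hn' : -(N : ℤ) ≤ n
      · exact ih n hn'
      have e := h (n + k)
      have e' := h' (n + k)
      rw [sum_Icc_neg_eq_add_sum_Ico _ (by omega)] at e e'
      rw [ih (n + k) (by push_cast at hn; omega), ← e'] at e
      have hs : ∑ j ∈ Finset.Ico (-k) k, a j (ψ (n + k - j)) =
          ∑ j ∈ Finset.Ico (-k) k, a j (ψ' (n + k - j)) := by
        refine Finset.sum_congr rfl fun j hj => ?_
        rw [Finset.mem_Ico] at hj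
        rw [ih (n + k - j) (by push_cast at hn; omega)]
      rw [hs, add_left_inj, add_sub_cancel_right] at e
      exact hak e
  funext n
  exact key n.natAbs n (by omega)

/-- A sequence satisfying a finite-range difference equation in degrees `≥ k` extends from the
nonnegative integers to a solution on all of `ℤ` if the leading coefficient is surjective. -/
theorem exists_recurrence_extension {V : Type} [NormedAddCommGroup V] [NormedSpace ℂ V]
    (a : ℤ → V →L[ℂ] V) {k : ℤ} (hk : 1 ≤ k) (hak : Function.Surjective (a k)) (z : ℂ)
    {φ : ℤ → V}
    (h : ∀ n : ℤ, k ≤ n → ∑ j ∈ Finset.Icc (-k) k, a j (φ (n - j)) = z • φ n) :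
    ∃ ψ : ℤ → V, (∀ n : ℤ, ∑ j ∈ Finset.Icc (-k) k, a j (ψ (n - j)) = z • ψ n) ∧
      ∀ n : ℤ, 0 ≤ n → ψ n = φ n := by
  obtain ⟨b, hb⟩ := hak.hasRightInverse
  set F : (ℤ → V) → ℤ → V := fun ψ m =>
    b (z • ψ (m + k) - ∑ j ∈ Finset.Ico (-k) k, a j (ψ (m + k - j))) with hFdef
  have hF : ∀ m ψ ψ', (∀ l, m < l → ψ l = ψ' l) → F ψ m = F ψ' m := by
    intro m ψ ψ' hψ
    simp only [hFdef]
    rw [hψ (m + k) (by omega)]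
    congr 2
    refine Finset.sum_congr rfl fun j hj => ?_
    rw [Finset.mem_Ico] at hj
    rw [hψ (m + k - j) (by omega)]
  refine ⟨backwardExtend F φ, fun n => ?_, fun n hn => backwardExtend_of_nonneg F φ hn⟩
  by_cases hn : k ≤ n
  · rw [backwardExtend_of_nonneg F φ (by omega : 0 ≤ n), ← h n hn]
    refine Finset.sum_congr rfl fun j hj => ?_
    rw [Finset.mem_Icc] at hj
    rw [backwardExtend_of_nonneg F φ (by omega)]
  · rw [sum_Icc_neg_eq_add_sum_Ico _ (by omega),
      backwardExtend_of_neg F φ hF (by omega : n - k < 0)]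
    simp only [hFdef]
    rw [hb, sub_add_cancel, sub_add_cancel]

theorem decaying_solutions_bijection
    {V : Type} [NormedAddCommGroup V] [InnerProductSpace ℂ V] [FiniteDimensional ℂ V]
    (A : ℤ → 𝕋 → (V →L[ℂ] V)) (hAcont : ∀ j, Continuous (A j))
    (hAsum : Summable fun j : ℤ => ⨆ t : 𝕋, ‖A j t‖)
    (H : 𝕋 → (L2 V →L[ℂ] L2 V))
    (hH : ∀ (t : 𝕋) (φ : L2 V) (n : ℤ), H t φ n = ∑' j : ℤ, A j t (φ (n - j)))
    (k : ℤ) (hk : 1 ≤ k) (hfin : ∀ j : ℤ, k < |j| → A j = 0)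
    (t : 𝕋) (hAk : IsUnit (A k t)) (hAmk : IsUnit (A (-k) t)) (z : ℂ) :
    (∀ ψ : ℤ → V,
      (∀ n : ℤ, ∑ j ∈ Finset.Icc (-k) k, A j t (ψ (n - j)) = z • ψ n) →
      (Summable fun n : ℕ => ‖ψ (n : ℤ)‖ ^ 2) →
      ∃ φ : L2 V, (∀ n : ℤ, 0 ≤ n → φ n = ψ n) ∧ (∀ n : ℤ, n < 0 → φ n = 0) ∧
        ∀ n : ℤ, k ≤ n → ((H t - z • 1) φ) n = 0) ∧
    (∀ ψ ψ' : ℤ → V,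
      (∀ n : ℤ, ∑ j ∈ Finset.Icc (-k) k, A j t (ψ (n - j)) = z • ψ n) →
      (Summable fun n : ℕ => ‖ψ (n : ℤ)‖ ^ 2) →
      (∀ n : ℤ, ∑ j ∈ Finset.Icc (-k) k, A j t (ψ' (n - j)) = z • ψ' n) →
      (Summable fun n : ℕ => ‖ψ' (n : ℤ)‖ ^ 2) →
      (∀ n : ℤ, 0 ≤ n → ψ n = ψ' n) → ψ = ψ') ∧
    (∀ φ : L2 V, (∀ n : ℤ, n < 0 → φ n = 0) →
      (∀ n : ℤ, k ≤ n → ((H t - z • 1) φ) n = 0) →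
      ∃ ψ : ℤ → V,
        (∀ n : ℤ, ∑ j ∈ Finset.Icc (-k) k, A j t (ψ (n - j)) = z • ψ n) ∧
        (Summable fun n : ℕ => ‖ψ (n : ℤ)‖ ^ 2) ∧
        ∀ n : ℤ, 0 ≤ n → ψ n = φ n) := by
  have hbij : Function.Bijective (A k t) := by
    obtain ⟨u, hu⟩ := hAk
    rw [← hu]
    exact (ContinuousLinearEquiv.unitsEquiv ℂ V u).bijective
  have hker : ∀ (φ : L2 V) (n : ℤ), ((H t - z • 1) φ) n =
      ∑ j ∈ Finset.Icc (-k) k, A j t (φ (n - j)) - z • φ n := by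
    intro φ n
    have h1 : ((H t - z • 1) φ) n = H t φ n - z • φ n := rfl
    rw [h1, hH, tsum_eq_sum]
    intro j hj
    rw [hfin j (by rw [Finset.mem_Icc, ← abs_le] at hj; exact not_le.mp hj)]
    rfl
  refine ⟨fun ψ hψ hsum => ?_, fun ψ ψ' hψ _ hψ' _ heq =>
    eq_of_recurrence_of_eq_nonneg (fun j => A j t) hk hbij.injective z hψ hψ' heq,
    fun φ _ hφ => ?_⟩
  · have hmem : Memℓp (fun n : ℤ => if 0 ≤ n then ψ n else 0) 2 := by
      refine memℓp_gen ?_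
      refine Summable.of_nat_of_neg_add_one ?_ ?_
      · simpa using hsum
      · refine summable_zero.congr fun n => ?_
        rw [if_neg (by omega)]
        simp
    refine ⟨⟨_, hmem⟩, fun n hn => if_pos hn, fun n hn => if_neg hn.not_ge, fun n hn => ?_⟩
    rw [hker, sub_eq_zero]
    change ∑ j ∈ Finset.Icc (-k) k, A j t (if 0 ≤ n - j then ψ (n - j) else 0) =
      z • (if 0 ≤ n then ψ n else 0)
    rw [if_pos (by omega : 0 ≤ n), ← hψ n]
    refine Finset.sum_congr rfl fun j hj => ?_
    rw [Finset.mem_Icc] at hj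
    rw [if_pos (by omega)]
  · obtain ⟨ψ, hψ, hψφ⟩ := exists_recurrence_extension (fun j => A j t) hk hbij.surjective z
      (φ := φ) fun n hn => by rw [← sub_eq_zero, ← hker]; exact hφ n hn
    refine ⟨ψ, hψ, ?_, hψφ⟩
    have hs : Summable fun n : ℤ => ‖φ n‖ ^ 2 := by
      simpa using (lp.memℓp φ).summable (by simp)
    refine (hs.comp_injective Nat.cast_injective).congr fun n => ?_
    simp [hψφ n (by omega)]
end
end
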